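/- Let A = kQ/I be the gentle algebra over an algebraically closed field k with quiver Q having vertices 1, 2, 3, 2', 3' and arrows a_1: 1→2, a_2: 2→3, a_3: 3→1, b_1: 1→2', b_2: 2'→3', b_3: 3'→1, and I = ⟨a_1a_2, a_2a_3, a_3a_1, b_1b_2, b_2b_3, b_3b_1⟩. Set Ā = A/Aε_1A. Then the simple module S(3') is an indecomposable projective right Ā-module, while S(3'), viewed as a right A-module, is a non-projective indecomposable G-projective A-module. (In particular, the conclusion of the reduction lemma for indecomposable projective Ā-modules fails when two full-relational oriented cycles share a vertex other than the endpoints of the chosen arrow.) -/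

import Mathlib

/- Common infrastructure: finite quivers, path algebras, gentle algebras,
   right modules, Gorenstein projective modules, etc. -/

open MulOpposite

noncomputable section

/-- A finite quiver, with `nV` vertices and `nE` arrows. -/
structure QuiverData where
  nV : ℕ
  nE : ℕ
  src : Fin nE → Fin nV
  tgt : Fin nE → Fin nV

/-- The relations defining the path algebra `kQ` as a quotient of the free
algebra on the set of vertices and arrows:  the trivial paths `e_v` are
orthogonal idempotents summing to `1`, and `e_{s(a)} * a = a = a * e_{t(a)}`.
(Paths are composed left-to-right, matching the paper's convention.) -/
inductive PathRel (k : Type) [Field k] (Q : QuiverData) :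
    FreeAlgebra k (Fin Q.nV ⊕ Fin Q.nE) → FreeAlgebra k (Fin Q.nV ⊕ Fin Q.nE) → Prop
  | vtx_mul (v w : Fin Q.nV) : PathRel k Q
      (FreeAlgebra.ι k (Sum.inl v) * FreeAlgebra.ι k (Sum.inl w))
      (if v = w then FreeAlgebra.ι k (Sum.inl v) else 0)
  | vtx_sum : PathRel k Q (∑ v : Fin Q.nV, FreeAlgebra.ι k (Sum.inl v)) 1
  | src_arr (e : Fin Q.nE) : PathRel k Q
      (FreeAlgebra.ι k (Sum.inl (Q.src e)) * FreeAlgebra.ι k (Sum.inr e))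
      (FreeAlgebra.ι k (Sum.inr e))
  | arr_tgt (e : Fin Q.nE) : PathRel k Q
      (FreeAlgebra.ι k (Sum.inr e) * FreeAlgebra.ι k (Sum.inl (Q.tgt e)))
      (FreeAlgebra.ι k (Sum.inr e))

/-- The path algebra `kQ`. -/
def PathAlg (k : Type) [Field k] (Q : QuiverData) := RingQuot (PathRel k Q)

instance (k : Type) [Field k] (Q : QuiverData) : Ring (PathAlg k Q) :=
  inferInstanceAs (Ring (RingQuot (PathRel k Q)))

instance (k : Type) [Field k] (Q : QuiverData) : Algebra k (PathAlg k Q) :=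
  inferInstanceAs (Algebra k (RingQuot (PathRel k Q)))

/-- The arrow `e`, as an element of the path algebra. -/
def arr (k : Type) [Field k] (Q : QuiverData) (e : Fin Q.nE) : PathAlg k Q :=
  RingQuot.mkAlgHom k (PathRel k Q) (FreeAlgebra.ι k (Sum.inr e))

/-- The trivial path (idempotent) at the vertex `v`, in the path algebra. -/
def vtx (k : Type) [Field k] (Q : QuiverData) (v : Fin Q.nV) : PathAlg k Q :=
  RingQuot.mkAlgHom k (PathRel k Q) (FreeAlgebra.ι k (Sum.inl v))

/-- Given a set `Rel` of (composable) pairs of arrows, the relation on `kQ`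
identifying each corresponding length-two path with `0`; the quotient is
`kQ/I` where `I` is the two-sided ideal generated by these paths of length two. -/
def GRel (k : Type) [Field k] (Q : QuiverData) (Rel : Set (Fin Q.nE × Fin Q.nE)) :
    PathAlg k Q → PathAlg k Q → Prop := fun x y =>
  (∃ p ∈ Rel, x = arr k Q p.1 * arr k Q p.2) ∧ y = 0

/-- The algebra `A = kQ/I`. -/
def GAlg (k : Type) [Field k] (Q : QuiverData) (Rel : Set (Fin Q.nE × Fin Q.nE)) :=
  RingQuot (GRel k Q Rel)

instance (k : Type) [Field k] (Q : QuiverData) (Rel : Set (Fin Q.nE × Fin Q.nE)) :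
    Ring (GAlg k Q Rel) := inferInstanceAs (Ring (RingQuot (GRel k Q Rel)))

instance (k : Type) [Field k] (Q : QuiverData) (Rel : Set (Fin Q.nE × Fin Q.nE)) :
    Algebra k (GAlg k Q Rel) := inferInstanceAs (Algebra k (RingQuot (GRel k Q Rel)))

/-- The canonical projection `kQ → kQ/I`. -/
def gmap (k : Type) [Field k] (Q : QuiverData) (Rel : Set (Fin Q.nE × Fin Q.nE)) :
    PathAlg k Q →ₐ[k] GAlg k Q Rel := RingQuot.mkAlgHom k (GRel k Q Rel)

/-- Membership in the ideal `I` (the kernel of `kQ → kQ/I`). -/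
def inI (k : Type) [Field k] (Q : QuiverData) (Rel : Set (Fin Q.nE × Fin Q.nE))
    (x : PathAlg k Q) : Prop := gmap k Q Rel x = 0

/-- The idempotent `ε_v ∈ A` at a vertex `v`. -/
def vtxA (k : Type) [Field k] (Q : QuiverData) (Rel : Set (Fin Q.nE × Fin Q.nE))
    (v : Fin Q.nV) : GAlg k Q Rel := gmap k Q Rel (vtx k Q v)

/-- The image in `A` of an arrow `e`. -/
def arrA (k : Type) [Field k] (Q : QuiverData) (Rel : Set (Fin Q.nE × Fin Q.nE))
    (e : Fin Q.nE) : GAlg k Q Rel := gmap k Q Rel (arr k Q e)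

/-- `(Q, I)` is a gentle pair (with `I` the ideal generated by the length-two
paths coming from `Rel`), and moreover `I` is admissible. -/
structure IsGentle (k : Type) [Field k] (Q : QuiverData)
    (Rel : Set (Fin Q.nE × Fin Q.nE)) : Prop where
  /-- the generating relations are composable length-two paths -/
  comp_rel : ∀ p ∈ Rel, Q.tgt p.1 = Q.src p.2
  /-- every vertex is the source of at most two arrows -/
  src_card : ∀ v, (Finset.univ.filter fun e => Q.src e = v).card ≤ 2
  /-- every vertex is the target of at most two arrows -/
  tgt_card : ∀ v, (Finset.univ.filter fun e => Q.tgt e = v).card ≤ 2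
  /-- for each arrow `a` there is at most one arrow `b` with `ab ∉ I` -/
  uniq_nonrel_right : ∀ a b c, ¬ inI k Q Rel (arr k Q a * arr k Q b) →
    ¬ inI k Q Rel (arr k Q a * arr k Q c) → b = c
  /-- for each arrow `a` there is at most one arrow `c` with `ca ∉ I` -/
  uniq_nonrel_left : ∀ a b c, ¬ inI k Q Rel (arr k Q b * arr k Q a) →
    ¬ inI k Q Rel (arr k Q c * arr k Q a) → b = c
  /-- for each arrow `a` there is at most one (composable) arrow `b` with `ab ∈ I` -/
  uniq_rel_right : ∀ a b c, Q.tgt a = Q.src b → Q.tgt a = Q.src c →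
    inI k Q Rel (arr k Q a * arr k Q b) → inI k Q Rel (arr k Q a * arr k Q c) → b = c
  /-- for each arrow `a` there is at most one (composable) arrow `c` with `ca ∈ I` -/
  uniq_rel_left : ∀ a b c, Q.tgt b = Q.src a → Q.tgt c = Q.src a →
    inI k Q Rel (arr k Q b * arr k Q a) → inI k Q Rel (arr k Q c * arr k Q a) → b = c
  /-- admissibility: some power of the arrow ideal is contained in `I` -/
  admissible : ∃ m, 2 ≤ m ∧ ∀ f : Fin m → Fin Q.nE,
    inI k Q Rel (List.ofFn fun i => arr k Q (f i)).prod

/-- A full-relational oriented cycle `𝒞 = a_1 ⋯ a_len` (of length ≥ 3, as assumed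
throughout the paper) in the bound quiver `(Q, I)`, encoded by a periodic
sequence of arrows.  `arrows i` is the arrow `a_{i+1}` (`0`-indexed),
consecutive arrows are composable, all consecutive length-two paths lie in `I`,
and the vertices of the cycle are pairwise distinct. -/
structure FRCycle (k : Type) [Field k] (Q : QuiverData)
    (Rel : Set (Fin Q.nE × Fin Q.nE)) where
  len : ℕ
  len3 : 3 ≤ len
  arrows : ℕ → Fin Q.nE
  periodic : ∀ i, arrows (i + len) = arrows i
  comp : ∀ i, Q.tgt (arrows i) = Q.src (arrows (i + 1))
  frel : ∀ i, inI k Q Rel (arr k Q (arrows i) * arr k Q (arrows (i + 1)))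
  vinj : ∀ i j, i < len → j < len → Q.src (arrows i) = Q.src (arrows j) → i = j

/-- There are no full-relational oriented cycles of length `< 3` (the blanket
assumption of the paper). -/
def NoShortFRC (k : Type) [Field k] (Q : QuiverData)
    (Rel : Set (Fin Q.nE × Fin Q.nE)) : Prop :=
  ∀ (l : ℕ) (c : ℕ → Fin Q.nE), 1 ≤ l → (∀ i, c (i + l) = c i) →
    (∀ i, Q.tgt (c i) = Q.src (c (i + 1))) →
    (∀ i, inI k Q Rel (arr k Q (c i) * arr k Q (c (i + 1)))) → 3 ≤ l

/-- The set of arrows lying on the cycle. -/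
def FRCycle.arrowSet {k : Type} [Field k] {Q : QuiverData}
    {Rel : Set (Fin Q.nE × Fin Q.nE)} (C : FRCycle k Q Rel) : Set (Fin Q.nE) :=
  {a | ∃ i < C.len, C.arrows i = a}

/-- The idempotent `ε_{𝒞,t} ∈ A`: the sum of the `ε_v` over the vertices `v`
of the cycle `𝒞` other than `s(a_t)` and `t(a_t)`. -/
def epsCt (k : Type) [Field k] (Q : QuiverData) (Rel : Set (Fin Q.nE × Fin Q.nE))
    (C : FRCycle k Q Rel) (t : ℕ) : GAlg k Q Rel :=
  ∑ i ∈ (Finset.range C.len).filter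
      (fun i => Q.src (C.arrows i) ≠ Q.src (C.arrows t) ∧
        Q.src (C.arrows i) ≠ Q.tgt (C.arrows t)),
    vtxA k Q Rel (Q.src (C.arrows i))

/-- The relation identifying an element `ε` of a ring with `0`; the quotient is
`R/RεR`. -/
def QuotRel (R : Type) [Ring R] (ε : R) : R → R → Prop := fun x y => x = ε ∧ y = 0

/-- The quotient ring `R/RεR`. -/
def QuotBy (R : Type) [Ring R] (ε : R) := RingQuot (QuotRel R ε)

instance (R : Type) [Ring R] (ε : R) : Ring (QuotBy R ε) :=
  inferInstanceAs (Ring (RingQuot (QuotRel R ε)))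

/-- The canonical projection `R → R/RεR`. -/
def qmap (R : Type) [Ring R] (ε : R) : R →+* QuotBy R ε := RingQuot.mkRingHom (QuotRel R ε)

/-- The right ideal `xR`, as a right `R`-module (i.e. an `Rᵐᵒᵖ`-submodule of `R`). -/
def rIdeal (R : Type) [Ring R] (x : R) : Submodule Rᵐᵒᵖ R := Submodule.span Rᵐᵒᵖ {x}

/-- Restriction of scalars along `π : R →+* S` turns a right `S`-module into a
right `R`-module. -/
def modRestrict {R S : Type} [Ring R] [Ring S] (π : R →+* S) (M : Type)
    [AddCommGroup M] [Module Sᵐᵒᵖ M] : Module Rᵐᵒᵖ M :=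
  Module.compHom M (RingHom.op π)

/-- `M` is a Gorenstein projective right `R`-module:  there is a complete
resolution, i.e. an exact sequence `⋯ → P⁻² → P⁻¹ → P⁰ → P¹ → ⋯` of finitely
generated projective right `R`-modules which stays exact after applying
`Hom_R(-, R)`, with `M ≅ Im(P⁻¹ → P⁰)`. -/
def IsGProjMod (R : Type) [Ring R] (M : Type) [AddCommGroup M] [Module Rᵐᵒᵖ M] : Prop :=
  ∃ (P : ℤ → ModuleCat.{0} Rᵐᵒᵖ) (d : (n : ℤ) → (P n →ₗ[Rᵐᵒᵖ] P (n + 1))),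
    (∀ n, Module.Finite Rᵐᵒᵖ (P n)) ∧
    (∀ n, Module.Projective Rᵐᵒᵖ (P n)) ∧
    (∀ n, LinearMap.range (d n) = LinearMap.ker (d (n + 1))) ∧
    (∀ (n : ℤ) (g : P (n + 1) →ₗ[Rᵐᵒᵖ] R),
      g.comp (d n) = 0 ↔ ∃ h : P (n + 1 + 1) →ₗ[Rᵐᵒᵖ] R, h.comp (d (n + 1)) = g) ∧
    Nonempty (M ≃ₗ[Rᵐᵒᵖ] LinearMap.range (d (-1)))

/-- `M` is an indecomposable `S`-module. -/
def IsIndec (S : Type) [Ring S] (M : Type) [AddCommGroup M] [Module S M] : Prop :=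
  Nontrivial M ∧ ∀ N₁ N₂ : Submodule S M, IsCompl N₁ N₂ → N₁ = ⊥ ∨ N₂ = ⊥

/-- `M` is a non-projective indecomposable Gorenstein projective right `R`-module. -/
def IsNPIGProj (R : Type) [Ring R] (M : Type) [AddCommGroup M] [Module Rᵐᵒᵖ M] : Prop :=
  IsGProjMod R M ∧ IsIndec Rᵐᵒᵖ M ∧ ¬ Module.Projective Rᵐᵒᵖ M

/-- A right `S`-module `M`, viewed as a right `R`-module along `π : R →+* S`, is a
non-projective indecomposable Gorenstein projective right `R`-module. -/
def RestrIsNPIGProj {R S : Type} [Ring R] [Ring S] (π : R →+* S) (M : Type)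
    [AddCommGroup M] [Module Sᵐᵒᵖ M] : Prop :=
  letI := modRestrict π M
  IsNPIGProj R M

/-- The submodule `M·(RεR)` of a right `R`-module `M`;  the quotient
`M ⧸ M·(RεR)` realizes the tensor product `M ⊗_R R/RεR`. -/
def smulIdeal (R : Type) [Ring R] (ε : R) (M : Type) [AddCommGroup M]
    [Module Rᵐᵒᵖ M] : Submodule Rᵐᵒᵖ M :=
  Submodule.span Rᵐᵒᵖ {m | ∃ (x : M) (a b : R), m = (op (a * ε * b)) • x}

/-- `S` has finitely many finitely generated indecomposable modules up to
isomorphism.  (Applied with `S = Aᵐᵒᵖ` this says `A` is representation-finite.) -/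
def RepFinite (S : Type) [Ring S] : Prop :=
  ∃ (n : ℕ) (M : Fin n → ModuleCat.{0} S), ∀ N : ModuleCat.{0} S,
    Module.Finite S N → IsIndec S N → ∃ i, Nonempty (N ≃ₗ[S] M i)

/-- A cycle in the underlying undirected graph of `Q`:  a closed walk of
length ≥ 1 along edges (each traversed forwards or backwards) with pairwise
distinct vertices and pairwise distinct edges. -/
structure UCycle (Q : QuiverData) where
  len : ℕ
  len1 : 1 ≤ len
  edges : ℕ → Fin Q.nE
  dir : ℕ → Bool
  vert : ℕ → Fin Q.nV
  pe : ∀ i, edges (i + len) = edges i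
  pd : ∀ i, dir (i + len) = dir i
  pv : ∀ i, vert (i + len) = vert i
  incid_t : ∀ i, dir i = true →
    Q.src (edges i) = vert i ∧ Q.tgt (edges i) = vert (i + 1)
  incid_f : ∀ i, dir i = false →
    Q.tgt (edges i) = vert i ∧ Q.src (edges i) = vert (i + 1)
  vdist : ∀ i j, i < len → j < len → vert i = vert j → i = j
  edist : ∀ i j, i < len → j < len → edges i = edges j → i = j

/-- The set of edges of an undirected cycle. -/
def UCycle.edgeSet {Q : QuiverData} (C : UCycle Q) : Set (Fin Q.nE) :=
  {e | ∃ i < C.len, C.edges i = e}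

/-- The underlying graph of `Q` has exactly one cycle. -/
def OneCycle (Q : QuiverData) : Prop :=
  Nonempty (UCycle Q) ∧ ∀ C C' : UCycle Q, C.edgeSet = C'.edgeSet

/-- The projective dimension of (the module underlying) `M` is at most `n`. -/
def projDimLE (S : Type) [Ring S] : ℕ → ModuleCat.{0} S → Prop
  | 0, M => Module.Projective S M
  | n + 1, M => ∃ (P : ModuleCat.{0} S) (f : P →ₗ[S] M), Module.Projective S P ∧
      Function.Surjective f ∧ projDimLE S n (ModuleCat.of S (LinearMap.ker f))

/-- The injective dimension of (the module underlying) `M` is at most `n`. -/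
def injDimLE (S : Type) [Ring S] : ℕ → ModuleCat.{0} S → Prop
  | 0, M => Module.Injective S M
  | n + 1, M => ∃ (J : ModuleCat.{0} S) (f : M →ₗ[S] J), Module.Injective S J ∧
      Function.Injective f ∧ injDimLE S n (ModuleCat.of S (J ⧸ LinearMap.range f))

end

/-- The quiver of Statement 16:  vertices `1, 2, 3, 2', 3'` (encoded
`0, 1, 2, 3, 4`) and arrows `a_1 : 1→2`, `a_2 : 2→3`, `a_3 : 3→1`, `b_1 : 1→2'`,
`b_2 : 2'→3'`, `b_3 : 3'→1` (encoded `0,…,5`). -/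
abbrev Q16 : QuiverData := ⟨5, 6, ![0, 1, 2, 0, 3, 4], ![1, 2, 0, 3, 4, 0]⟩

/-- The relations `a_1a_2, a_2a_3, a_3a_1, b_1b_2, b_2b_3, b_3b_1`. -/
def Rel16 : Set (Fin Q16.nE × Fin Q16.nE) :=
  {(0, 1), (1, 2), (2, 0), (3, 4), (4, 5), (5, 3)}

section RightIdeals

variable {R : Type} [Ring R]

theorem mem_rIdeal {a x : R} : x ∈ rIdeal R a ↔ ∃ y, a * y = x := by
  rw [rIdeal, Submodule.mem_span_singleton]
  exact ⟨fun ⟨r, hr⟩ => ⟨r.unop, hr⟩, fun ⟨y, hy⟩ => ⟨op y, hy⟩⟩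

theorem self_mem_rIdeal (a : R) : a ∈ rIdeal R a := mem_rIdeal.2 ⟨1, mul_one a⟩

theorem mul_eq_of_mem_rIdeal {e x : R} (he : e * e = e) (hx : x ∈ rIdeal R e) : e * x = x := by
  obtain ⟨y, rfl⟩ := mem_rIdeal.1 hx
  rw [← mul_assoc, he]

/-- A ring is free of rank one as a right module over itself. -/
theorem projective_mulOpposite_self : Module.Projective Rᵐᵒᵖ R :=
  let e : Rᵐᵒᵖ ≃ₗ[Rᵐᵒᵖ] R := { (opAddEquiv (α := R)).symm with map_smul' := fun _ _ => rfl }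
  Module.Projective.of_equiv e

theorem projective_rIdeal {e : R} (he : e * e = e) : Module.Projective Rᵐᵒᵖ (rIdeal R e) := by
  have := projective_mulOpposite_self (R := R)
  refine Module.Projective.of_split (rIdeal R e).subtype (
    (LinearMap.mulLeft Rᵐᵒᵖ e).codRestrict (rIdeal R e) fun x => mem_rIdeal.2 ⟨x, rfl⟩) ?_
  ext x
  exact mul_eq_of_mem_rIdeal he x.2

theorem finite_rIdeal (a : R) : Module.Finite Rᵐᵒᵖ (rIdeal R a) :=
  Module.Finite.span_singleton _ _

/-- Left multiplication by `b = e' b`, as a homomorphism `eR → e'R` of right modules. -/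
def rIdealMul (e : R) {e' b : R} (hb : e' * b = b) : rIdeal R e →ₗ[Rᵐᵒᵖ] rIdeal R e' :=
  ((LinearMap.mulLeft Rᵐᵒᵖ b).comp (rIdeal R e).subtype).codRestrict (rIdeal R e')
    fun x => mem_rIdeal.2 ⟨b * x, by simp [← mul_assoc, hb]⟩

@[simp] theorem coe_rIdealMul (e : R) {e' b : R} (hb : e' * b = b) (x : rIdeal R e) :
    (rIdealMul e hb x : R) = b * x := rfl

/-- A sequence of elements `b n ∈ e (n + 1) R e n` whose left and right multiplications are exact
exhibits every right module isomorphic to `b (-1) R` as Gorenstein projective. -/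
theorem isGProjMod_of_exact_seq (e b : ℤ → R) (he : ∀ n, e n * e n = e n)
    (hl : ∀ n, e (n + 1) * b n = b n) (hr : ∀ n, b n * e n = b n)
    (hz : ∀ n, b (n + 1) * b n = 0)
    (hker : ∀ n x, e (n + 1) * x = x → b (n + 1) * x = 0 → ∃ y, b n * y = x)
    (hker' : ∀ n x, x * e (n + 1) = x → x * b n = 0 → ∃ y, y * b (n + 1) = x)
    (M : Type) [AddCommGroup M] [Module Rᵐᵒᵖ M]
    (f : M ≃ₗ[Rᵐᵒᵖ] rIdeal R (b (-1))) : IsGProjMod R M := by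
  refine ⟨fun n => ModuleCat.of Rᵐᵒᵖ (rIdeal R (e n)), fun n => rIdealMul (e n) (hl n),
    fun n => finite_rIdeal _, fun n => projective_rIdeal (he n), fun n => ?_, fun n g => ?_, ?_⟩
  · ext x
    change (∃ y, rIdealMul (e n) (hl n) y = x) ↔ rIdealMul (e (n + 1)) (hl (n + 1)) x = 0
    constructor
    · rintro ⟨y, rfl⟩
      ext
      simp [← mul_assoc, hz]
    · intro h
      obtain ⟨y, hy⟩ := hker n x (mul_eq_of_mem_rIdeal (he _) x.2) (congrArg Subtype.val h)
      refine ⟨⟨e n * y, mem_rIdeal.2 ⟨y, rfl⟩⟩, ?_⟩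
      ext
      rw [coe_rIdealMul, ← mul_assoc, hr, hy]
  · change rIdeal R (e (n + 1)) →ₗ[Rᵐᵒᵖ] R at g
    change g.comp (rIdealMul (e n) (hl n)) = 0 ↔
      ∃ h : rIdeal R (e (n + 1 + 1)) →ₗ[Rᵐᵒᵖ] R,
        h.comp (rIdealMul (e (n + 1)) (hl (n + 1))) = g
    constructor
    · intro hg
      have key : ∀ x : rIdeal R (e (n + 1)),
          g x = g ⟨e (n + 1), self_mem_rIdeal _⟩ * x := by
        intro x
        have : x = op (x : R) • (⟨e (n + 1), self_mem_rIdeal _⟩ : rIdeal R (e (n + 1))) := by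
          ext
          exact (mul_eq_of_mem_rIdeal (he _) x.2).symm
        conv_lhs => rw [this, map_smul]
        rfl
      obtain ⟨y, hy⟩ := hker' n (g ⟨e (n + 1), self_mem_rIdeal _⟩) (key ⟨e (n + 1), _⟩).symm (by
        have h1 := LinearMap.congr_fun hg ⟨e n, self_mem_rIdeal _⟩
        rw [LinearMap.comp_apply, key, coe_rIdealMul] at h1
        simpa [hr] using h1)
      refine ⟨(LinearMap.mulLeft Rᵐᵒᵖ y).comp
        (rIdeal R (e (n + 1 + 1))).subtype, ?_⟩
      ext x
      rw [key, ← hy]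
      simp [mul_assoc]
    · rintro ⟨h, rfl⟩
      ext x
      have : rIdealMul (e (n + 1)) (hl (n + 1)) (rIdealMul (e n) (hl n) x) = 0 := by
        ext
        simp [← mul_assoc, hz]
      simp [this]
  · change Nonempty (M ≃ₗ[Rᵐᵒᵖ] LinearMap.range (rIdealMul (e (-1)) (hl (-1))))
    let d := rIdealMul (e (-1)) (hl (-1))
    have hrange : rIdeal R (b (-1)) = (LinearMap.range d).map (rIdeal R (e (-1 + 1))).subtype := by
      ext x
      rw [mem_rIdeal]
      constructor
      · rintro ⟨y, rfl⟩
        refine ⟨_, ⟨⟨e (-1) * y, mem_rIdeal.2 ⟨y, rfl⟩⟩, rfl⟩, ?_⟩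
        change b (-1) * (e (-1) * y) = _
        rw [← mul_assoc, hr]
      · rintro ⟨_, ⟨y, rfl⟩, rfl⟩
        exact ⟨y, rfl⟩
    exact ⟨f.trans ((LinearEquiv.ofEq _ _ hrange).trans
      ((rIdeal R (e (-1 + 1))).equivSubtypeMap (LinearMap.range d)).symm)⟩

end RightIdeals

theorem isIndec_of_isSimpleModule (S M : Type) [Ring S] [AddCommGroup M] [Module S M]
    [IsSimpleModule S M] : IsIndec S M := by
  refine ⟨IsSimpleModule.nontrivial S M, fun N₁ N₂ h => ?_⟩
  rcases eq_bot_or_eq_top N₁ with h₁ | h₁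
  · exact Or.inl h₁
  · subst h₁
    exact Or.inr (top_disjoint.1 h.disjoint)

/-- Surjections from the same module with equal kernels have isomorphic targets. -/
theorem nonempty_linearEquiv_of_ker_eq {S M N P : Type} [Ring S] [AddCommGroup M] [Module S M]
    [AddCommGroup N] [Module S N] [AddCommGroup P] [Module S P] (f : M →ₗ[S] N) (g : M →ₗ[S] P)
    (hf : Function.Surjective f) (hg : Function.Surjective g)
    (h : LinearMap.ker f = LinearMap.ker g) : Nonempty (N ≃ₗ[S] P) :=
  ⟨(f.quotKerEquivOfSurjective hf).symm.trans
    ((Submodule.quotEquivOfEq _ _ h).trans (g.quotKerEquivOfSurjective hg))⟩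

section GAlg

variable {k : Type} [Field k] {Q : QuiverData} {Rel : Set (Fin Q.nE × Fin Q.nE)}

theorem vtxA_mul_vtxA (v w : Fin Q.nV) :
    vtxA k Q Rel v * vtxA k Q Rel w = if v = w then vtxA k Q Rel v else 0 := by
  have h : vtx k Q v * vtx k Q w = if v = w then vtx k Q v else 0 := by
    have := RingQuot.mkAlgHom_rel k (PathRel.vtx_mul (k := k) (Q := Q) v w)
    rw [map_mul] at this
    refine this.trans ?_
    split_ifs
    · rfl
    · exact map_zero _
  rw [vtxA, vtxA, ← map_mul, h]
  split_ifs
  · rfl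
  · exact map_zero _

theorem vtxA_src_mul_arrA (a : Fin Q.nE) :
    vtxA k Q Rel (Q.src a) * arrA k Q Rel a = arrA k Q Rel a := by
  have h : vtx k Q (Q.src a) * arr k Q a = arr k Q a := by
    have := RingQuot.mkAlgHom_rel k (PathRel.src_arr (k := k) (Q := Q) a)
    rw [map_mul] at this
    exact this
  rw [vtxA, arrA, ← map_mul, h]

theorem arrA_mul_vtxA_tgt (a : Fin Q.nE) :
    arrA k Q Rel a * vtxA k Q Rel (Q.tgt a) = arrA k Q Rel a := by
  have h : arr k Q a * vtx k Q (Q.tgt a) = arr k Q a := by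
    have := RingQuot.mkAlgHom_rel k (PathRel.arr_tgt (k := k) (Q := Q) a)
    rw [map_mul] at this
    exact this
  rw [vtxA, arrA, ← map_mul, h]

theorem vtxA_mul_arrA (v : Fin Q.nV) (a : Fin Q.nE) :
    vtxA k Q Rel v * arrA k Q Rel a = if Q.src a = v then arrA k Q Rel a else 0 := by
  rw [← vtxA_src_mul_arrA a, ← mul_assoc, vtxA_mul_vtxA]
  by_cases h : v = Q.src a
  · subst h; simp
  · simp [h, Ne.symm h]

theorem arrA_mul_vtxA (a : Fin Q.nE) (v : Fin Q.nV) :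
    arrA k Q Rel a * vtxA k Q Rel v = if Q.tgt a = v then arrA k Q Rel a else 0 := by
  rw [← arrA_mul_vtxA_tgt a, mul_assoc, vtxA_mul_vtxA, mul_ite, mul_zero]

theorem arrA_mul_arrA_of_mem {a b : Fin Q.nE} (h : (a, b) ∈ Rel) :
    arrA k Q Rel a * arrA k Q Rel b = 0 := by
  have : GRel k Q Rel (arr k Q a * arr k Q b) 0 := ⟨⟨_, h, rfl⟩, rfl⟩
  have := RingQuot.mkAlgHom_rel k this
  rw [map_mul, map_zero] at this
  exact this

theorem arrA_mul_arrA_of_ne {a b : Fin Q.nE} (h : Q.tgt a ≠ Q.src b) :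
    arrA k Q Rel a * arrA k Q Rel b = 0 := by
  rw [← arrA_mul_vtxA_tgt a, mul_assoc, vtxA_mul_arrA, if_neg h.symm, mul_zero]

theorem GAlg.induction {p : GAlg k Q Rel → Prop} (scalar : ∀ c, p (algebraMap k _ c))
    (vertex : ∀ v, p (vtxA k Q Rel v)) (arrow : ∀ a, p (arrA k Q Rel a))
    (mul : ∀ x y, p x → p y → p (x * y)) (add : ∀ x y, p x → p y → p (x + y))
    (x : GAlg k Q Rel) : p x := by
  let F : FreeAlgebra k (Fin Q.nV ⊕ Fin Q.nE) →ₐ[k] GAlg k Q Rel :=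
    (gmap k Q Rel).comp (RingQuot.mkAlgHom k (PathRel k Q))
  have hF : Function.Surjective F :=
    (RingQuot.mkAlgHom_surjective k (GRel k Q Rel)).comp
      (RingQuot.mkAlgHom_surjective k (PathRel k Q))
  obtain ⟨z, rfl⟩ := hF x
  induction z with
  | grade0 c => rw [AlgHom.commutes]; exact scalar c
  | grade1 i => exact i.casesOn vertex arrow
  | mul y z hy hz => rw [map_mul]; exact mul _ _ hy hz
  | add y z hy hz => rw [map_add]; exact add _ _ hy hz

theorem exists_vtxA_mul_eq (v : Fin Q.nV) (x : GAlg k Q Rel) :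
    ∃ (c : k) (y : Fin Q.nE → GAlg k Q Rel), vtxA k Q Rel v * x =
      c • vtxA k Q Rel v + ∑ a, if Q.src a = v then arrA k Q Rel a * y a else 0 := by
  induction x using GAlg.induction with
  | scalar c => exact ⟨c, 0, by simp [Algebra.algebraMap_eq_smul_one]⟩
  | vertex w =>
    rw [vtxA_mul_vtxA]
    exact ⟨if v = w then 1 else 0, 0, by split_ifs <;> simp⟩
  | arrow b =>
    refine ⟨0, Pi.single b 1, ?_⟩
    rw [vtxA_mul_arrA, Finset.sum_eq_single b] <;> simp +contextual
  | mul x x' hx hx' =>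
    obtain ⟨c, y, h⟩ := hx
    obtain ⟨c', y', h'⟩ := hx'
    refine ⟨c * c', fun a => c • y' a + y a * x', ?_⟩
    rw [← mul_assoc, h, add_mul, smul_mul_assoc, h', smul_add, smul_smul, add_assoc,
      Finset.smul_sum, Finset.sum_mul, ← Finset.sum_add_distrib]
    congr 1
    refine Finset.sum_congr rfl fun a _ => ?_
    split_ifs <;> simp [mul_add, mul_assoc]
  | add x x' hx hx' =>
    obtain ⟨c, y, h⟩ := hx
    obtain ⟨c', y', h'⟩ := hx'
    refine ⟨c + c', y + y', ?_⟩
    rw [mul_add, h, h', add_smul, add_add_add_comm, ← Finset.sum_add_distrib]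
    congr 1
    refine Finset.sum_congr rfl fun a _ => ?_
    split_ifs <;> simp [mul_add]

theorem exists_mul_vtxA_eq (v : Fin Q.nV) (x : GAlg k Q Rel) :
    ∃ (c : k) (y : Fin Q.nE → GAlg k Q Rel), x * vtxA k Q Rel v =
      c • vtxA k Q Rel v + ∑ a, if Q.tgt a = v then y a * arrA k Q Rel a else 0 := by
  induction x using GAlg.induction with
  | scalar c => exact ⟨c, 0, by simp [Algebra.algebraMap_eq_smul_one]⟩
  | vertex w =>
    rw [vtxA_mul_vtxA]
    refine ⟨if w = v then 1 else 0, 0, ?_⟩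
    split_ifs with h
    · simp [h]
    · simp
  | arrow b =>
    refine ⟨0, Pi.single b 1, ?_⟩
    rw [arrA_mul_vtxA, Finset.sum_eq_single b] <;> simp +contextual
  | mul x x' hx hx' =>
    obtain ⟨c, y, h⟩ := hx
    obtain ⟨c', y', h'⟩ := hx'
    refine ⟨c' * c, fun a => c' • y a + x * y' a, ?_⟩
    rw [mul_assoc, h', mul_add, mul_smul_comm, h, smul_add, smul_smul, add_assoc,
      Finset.smul_sum, Finset.mul_sum, ← Finset.sum_add_distrib]
    congr 1
    refine Finset.sum_congr rfl fun a _ => ?_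
    split_ifs <;> simp [add_mul, mul_assoc]
  | add x x' hx hx' =>
    obtain ⟨c, y, h⟩ := hx
    obtain ⟨c', y', h'⟩ := hx'
    refine ⟨c + c', y + y', ?_⟩
    rw [add_mul, h, h', add_smul, add_add_add_comm, ← Finset.sum_add_distrib]
    congr 1
    refine Finset.sum_congr rfl fun a _ => ?_
    split_ifs <;> simp [add_mul]

theorem GAlg.exists_algHom {B : Type} [Ring B] [Algebra k B] (f : Fin Q.nV → B) (g : Fin Q.nE → B)
    (hmul : ∀ v w, f v * f w = if v = w then f v else 0) (hsum : ∑ v, f v = 1)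
    (hsrc : ∀ a, f (Q.src a) * g a = g a) (htgt : ∀ a, g a * f (Q.tgt a) = g a)
    (hrel : ∀ p ∈ Rel, g p.1 * g p.2 = 0) :
    ∃ F : GAlg k Q Rel →ₐ[k] B,
      (∀ v, F (vtxA k Q Rel v) = f v) ∧ ∀ a, F (arrA k Q Rel a) = g a := by
  let F₀ : FreeAlgebra k (Fin Q.nV ⊕ Fin Q.nE) →ₐ[k] B := FreeAlgebra.lift k (Sum.elim f g)
  have h₀ : ∀ ⦃x y⦄, PathRel k Q x y → F₀ x = F₀ y := by
    intro x y h
    cases h with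
    | vtx_mul v w =>
      have := hmul v w
      split_ifs at this ⊢ <;> simpa [F₀] using this
    | vtx_sum => simpa [F₀] using hsum
    | src_arr a => simpa [F₀] using hsrc a
    | arr_tgt a => simpa [F₀] using htgt a
  let F₁ : PathAlg k Q →ₐ[k] B := RingQuot.liftAlgHom k ⟨F₀, h₀⟩
  have hv : ∀ v, F₁ (vtx k Q v) = f v := fun v =>
    (RingQuot.liftAlgHom_mkAlgHom_apply k F₀ h₀ _).trans (by simp [F₀])
  have ha : ∀ a, F₁ (arr k Q a) = g a := fun a =>
    (RingQuot.liftAlgHom_mkAlgHom_apply k F₀ h₀ _).trans (by simp [F₀])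
  have h₁ : ∀ ⦃x y⦄, GRel k Q Rel x y → F₁ x = F₁ y := by
    rintro x y ⟨⟨p, hp, rfl⟩, rfl⟩
    rw [map_mul, map_zero, ha, ha, hrel p hp]
  exact ⟨RingQuot.liftAlgHom k ⟨F₁, h₁⟩,
    fun v => (RingQuot.liftAlgHom_mkAlgHom_apply k F₁ h₁ _).trans (hv v),
    fun a => (RingQuot.liftAlgHom_mkAlgHom_apply k F₁ h₁ _).trans (ha a)⟩

end GAlg

section Example

variable {k : Type} [Field k]

/-- The image of an arrow in the algebra of the example. -/
abbrev arr16 (k : Type) [Field k] (a : Fin 6) : GAlg k Q16 Rel16 := arrA k Q16 Rel16 a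

/-- The image of a trivial path in the algebra of the example. -/
abbrev vtx16 (k : Type) [Field k] (v : Fin 5) : GAlg k Q16 Rel16 := vtxA k Q16 Rel16 v

theorem exists_algHom16 {B : Type} [Ring B] [Algebra k B] (f : Fin 5 → B) (g : Fin 6 → B)
    (hmul : ∀ v w, f v * f w = if v = w then f v else 0) (hsum : ∑ v, f v = 1)
    (hsrc : ∀ a, f (Q16.src a) * g a = g a) (htgt : ∀ a, g a * f (Q16.tgt a) = g a)
    (hrel : ∀ p ∈ Rel16, g p.1 * g p.2 = 0) :
    ∃ F : GAlg k Q16 Rel16 →ₐ[k] B,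
      (∀ v, F (vtx16 k v) = f v) ∧ ∀ a, F (arr16 k a) = g a :=
  GAlg.exists_algHom (Q := Q16) f g hmul hsum hsrc htgt hrel

theorem sum_single_eq_one :
    (Matrix.single 0 0 1 + Matrix.single 1 1 1 + Matrix.single 2 2 1 :
      Matrix (Fin 3) (Fin 3) k) = 1 := by
  ext i j
  fin_cases i <;> fin_cases j <;> simp [Matrix.single]

theorem arr16_two_mul_three_ne_zero : arr16 k 2 * arr16 k 3 ≠ 0 := by
  obtain ⟨F, -, hF⟩ := exists_algHom16 (k := k) (B := Matrix (Fin 3) (Fin 3) k)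
    ![.single 1 1 1, 0, .single 0 0 1, .single 2 2 1, 0]
    ![0, 0, .single 0 1 1, .single 1 2 1, 0, 0]
    (by intro v w; fin_cases v <;> fin_cases w <;> simp)
    (by rw [← sum_single_eq_one]; simp [Fin.sum_univ_succ]; abel)
    (by intro a; fin_cases a <;> simp) (by intro a; fin_cases a <;> simp)
    (by simp [Rel16])
  intro h
  have h1 := congrArg F h
  rw [map_mul, map_zero, hF, hF] at h1
  simpa using congrFun (congrFun h1 0) 2

theorem arr16_five_mul_zero_ne_zero : arr16 k 5 * arr16 k 0 ≠ 0 := by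
  obtain ⟨F, -, hF⟩ := exists_algHom16 (k := k) (B := Matrix (Fin 3) (Fin 3) k)
    ![.single 1 1 1, .single 2 2 1, 0, 0, .single 0 0 1]
    ![.single 1 2 1, 0, 0, 0, 0, .single 0 1 1]
    (by intro v w; fin_cases v <;> fin_cases w <;> simp)
    (by rw [← sum_single_eq_one]; simp [Fin.sum_univ_succ]; abel)
    (by intro a; fin_cases a <;> simp) (by intro a; fin_cases a <;> simp)
    (by simp [Rel16])
  intro h
  have h1 := congrArg F h
  rw [map_mul, map_zero, hF, hF] at h1
  simpa using congrFun (congrFun h1 0) 2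

theorem arr16_four_ne_zero : arr16 k 4 ≠ 0 := by
  obtain ⟨F, -, hF⟩ := exists_algHom16 (k := k) (B := Matrix (Fin 3) (Fin 3) k)
    ![.single 2 2 1, 0, 0, .single 0 0 1, .single 1 1 1]
    ![0, 0, 0, 0, .single 0 1 1, 0]
    (by intro v w; fin_cases v <;> fin_cases w <;> simp)
    (by rw [← sum_single_eq_one]; simp [Fin.sum_univ_succ]; abel)
    (by intro a; fin_cases a <;> simp) (by intro a; fin_cases a <;> simp)
    (by simp [Rel16])
  intro h
  have h1 := congrArg F h
  rw [map_zero, hF] at h1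
  simpa using congrFun (congrFun h1 0) 1

theorem qmap_vtx16_four_ne_zero : qmap (GAlg k Q16 Rel16) (vtx16 k 0) (vtx16 k 4) ≠ 0 := by
  obtain ⟨F, hF, -⟩ := exists_algHom16 (k := k) (B := k) ![0, 0, 0, 0, 1] 0
    (by intro v w; fin_cases v <;> fin_cases w <;> simp)
    (by simp [Fin.sum_univ_succ]) (by simp) (by simp) (by simp)
  have hrel : ∀ ⦃x y⦄, QuotRel (GAlg k Q16 Rel16) (vtx16 k 0) x y →
      (F : GAlg k Q16 Rel16 →+* k) x = (F : GAlg k Q16 Rel16 →+* k) y := by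
    rintro x y ⟨rfl, rfl⟩
    simp [hF]
  intro h
  have h1 := congrArg (RingQuot.lift ⟨(F : GAlg k Q16 Rel16 →+* k), hrel⟩) h
  have h2 := RingQuot.lift_mkRingHom_apply (F : GAlg k Q16 Rel16 →+* k) hrel (vtx16 k 4)
  have h3 := h2.symm.trans (h1.trans (map_zero _))
  simp [hF] at h3

theorem arr16_three_ne_zero : arr16 k 3 ≠ 0 := fun h =>
  arr16_two_mul_three_ne_zero (k := k) (by rw [h, mul_zero])

theorem arr16_five_ne_zero : arr16 k 5 ≠ 0 := fun h =>
  arr16_five_mul_zero_ne_zero (k := k) (by rw [h, zero_mul])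

theorem arr16_mul_arr16_eq_zero {a b : Fin 6} (h : (a, b) ≠ (2, 3)) (h' : (a, b) ≠ (5, 0)) :
    arr16 k a * arr16 k b = 0 := by
  by_cases hab : Q16.tgt a = Q16.src b
  · refine arrA_mul_arrA_of_mem ?_
    fin_cases a <;> fin_cases b <;> simp_all [Rel16]
  · exact arrA_mul_arrA_of_ne hab

theorem exists_vtx16_mul_eq (v : Fin 5) (a : Fin 6) (h : ∀ b, Q16.src b = v ↔ b = a)
    (x : GAlg k Q16 Rel16) :
    ∃ (c : k) (y : GAlg k Q16 Rel16), vtx16 k v * x = c • vtx16 k v + arr16 k a * y := by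
  obtain ⟨c, y, hx⟩ := exists_vtxA_mul_eq (Q := Q16) v x
  refine ⟨c, y a, hx.trans ?_⟩
  simp [h]

theorem exists_mul_vtx16_eq (v : Fin 5) (a : Fin 6) (h : ∀ b, Q16.tgt b = v ↔ b = a)
    (x : GAlg k Q16 Rel16) :
    ∃ (c : k) (y : GAlg k Q16 Rel16), x * vtx16 k v = c • vtx16 k v + y * arr16 k a := by
  obtain ⟨c, y, hx⟩ := exists_mul_vtxA_eq (Q := Q16) v x
  refine ⟨c, y a, hx.trans ?_⟩
  simp [h]

theorem vtx16_zero_mul_eq (x : GAlg k Q16 Rel16) : ∃ (c d d' : k),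
    vtx16 k 0 * x = c • vtx16 k 0 + d • arr16 k 0 + d' • arr16 k 3 := by
  obtain ⟨c, y, hx⟩ := exists_vtxA_mul_eq (Q := Q16) 0 x
  obtain ⟨d, z, hz⟩ := exists_vtx16_mul_eq 1 1 (by decide) (y 0)
  obtain ⟨d', z', hz'⟩ := exists_vtx16_mul_eq 3 4 (by decide) (y 3)
  have h0 : arr16 k 0 * y 0 = d • arr16 k 0 := by
    have h := arrA_mul_vtxA_tgt (k := k) (Q := Q16) (Rel := Rel16) 0
    have h1 : arr16 k 0 * vtx16 k 1 = arr16 k 0 := h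
    rw [← h1, mul_assoc, hz, mul_add, mul_smul_comm, ← mul_assoc _ (arr16 k 1),
      arr16_mul_arr16_eq_zero (by decide) (by decide), zero_mul, add_zero]
  have h3 : arr16 k 3 * y 3 = d' • arr16 k 3 := by
    have h := arrA_mul_vtxA_tgt (k := k) (Q := Q16) (Rel := Rel16) 3
    have h1 : arr16 k 3 * vtx16 k 3 = arr16 k 3 := h
    rw [← h1, mul_assoc, hz', mul_add, mul_smul_comm, ← mul_assoc _ (arr16 k 4),
      arr16_mul_arr16_eq_zero (by decide) (by decide), zero_mul, add_zero]
  refine ⟨c, d, d', hx.trans ?_⟩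
  rw [add_assoc, ← h0, ← h3]
  simp [Fin.sum_univ_succ]

theorem mul_vtx16_zero_eq (x : GAlg k Q16 Rel16) : ∃ (c d d' : k),
    x * vtx16 k 0 = c • vtx16 k 0 + d • arr16 k 2 + d' • arr16 k 5 := by
  obtain ⟨c, y, hx⟩ := exists_mul_vtxA_eq (Q := Q16) 0 x
  obtain ⟨d, z, hz⟩ := exists_mul_vtx16_eq 2 1 (by decide) (y 2)
  obtain ⟨d', z', hz'⟩ := exists_mul_vtx16_eq 4 4 (by decide) (y 5)
  have h2 : y 2 * arr16 k 2 = d • arr16 k 2 := by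
    have h1 : vtx16 k 2 * arr16 k 2 = arr16 k 2 := vtxA_src_mul_arrA (Q := Q16) 2
    rw [← h1, ← mul_assoc, hz, add_mul, smul_mul_assoc, mul_assoc _ (arr16 k 1),
      arr16_mul_arr16_eq_zero (by decide) (by decide), mul_zero, add_zero]
  have h5 : y 5 * arr16 k 5 = d' • arr16 k 5 := by
    have h1 : vtx16 k 4 * arr16 k 5 = arr16 k 5 := vtxA_src_mul_arrA (Q := Q16) 5
    rw [← h1, ← mul_assoc, hz', add_mul, smul_mul_assoc, mul_assoc _ (arr16 k 4),
      arr16_mul_arr16_eq_zero (by decide) (by decide), mul_zero, add_zero]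
  refine ⟨c, d, d', hx.trans ?_⟩
  rw [add_assoc, ← h2, ← h5]
  simp [Fin.sum_univ_succ]

theorem vtx16_mul_arr16 (v : Fin 5) (a : Fin 6) :
    vtx16 k v * arr16 k a = if Q16.src a = v then arr16 k a else 0 :=
  vtxA_mul_arrA (Q := Q16) v a

theorem arr16_mul_vtx16 (a : Fin 6) (v : Fin 5) :
    arr16 k a * vtx16 k v = if Q16.tgt a = v then arr16 k a else 0 :=
  arrA_mul_vtxA (Q := Q16) a v

theorem vtx16_mul_self (v : Fin 5) : vtx16 k v * vtx16 k v = vtx16 k v := by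
  simpa using vtxA_mul_vtxA (k := k) (Q := Q16) (Rel := Rel16) v v

/-- The trivial paths along the relational cycle through `2'` and `3'`, in the order in which its
projective modules occur in the complete resolution of `S(3')`. -/
def cycleVtx (k : Type) [Field k] : ZMod 3 → GAlg k Q16 Rel16 :=
  ![vtx16 k 3, vtx16 k 0, vtx16 k 4]

/-- The arrows of the relational cycle through `2'` and `3'`, in the order in which they occur in
the complete resolution of `S(3')`. -/
def cycleArr (k : Type) [Field k] : ZMod 3 → GAlg k Q16 Rel16 :=
  ![arr16 k 3, arr16 k 5, arr16 k 4]

theorem forall_zmod_three {p : ZMod 3 → Prop} (h0 : p 0) (h1 : p 1) (h2 : p 2) (i : ZMod 3) :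
    p i := by
  fin_cases i
  exacts [h0, h1, h2]

theorem exists_mul_eq_of_mul_eq_zero {v : Fin 5} {a b : Fin 6}
    (hv : ∀ c, Q16.src c = v ↔ c = a) (hb : Q16.tgt b = v) (hne : arr16 k b ≠ 0)
    (hba : arr16 k b * arr16 k a = 0) {x : GAlg k Q16 Rel16}
    (hx : vtx16 k v * x = x) (h : arr16 k b * x = 0) : ∃ y, arr16 k a * y = x := by
  obtain ⟨c, y, hy⟩ := exists_vtx16_mul_eq v a hv x
  rw [hx] at hy
  rw [hy, mul_add, ← mul_assoc, hba, zero_mul, add_zero, mul_smul_comm, arr16_mul_vtx16,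
    if_pos hb] at h
  obtain rfl := (smul_eq_zero.1 h).resolve_right hne
  exact ⟨y, by rw [hy, zero_smul, zero_add]⟩

theorem exists_eq_mul_of_mul_eq_zero {v : Fin 5} {a b : Fin 6}
    (hv : ∀ c, Q16.tgt c = v ↔ c = a) (hb : Q16.src b = v) (hne : arr16 k b ≠ 0)
    (hab : arr16 k a * arr16 k b = 0) {x : GAlg k Q16 Rel16}
    (hx : x * vtx16 k v = x) (h : x * arr16 k b = 0) : ∃ y, y * arr16 k a = x := by
  obtain ⟨c, y, hy⟩ := exists_mul_vtx16_eq v a hv x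
  rw [hx] at hy
  rw [hy, add_mul, mul_assoc, hab, mul_zero, add_zero, smul_mul_assoc, vtx16_mul_arr16,
    if_pos hb] at h
  obtain rfl := (smul_eq_zero.1 h).resolve_right hne
  exact ⟨y, by rw [hy, zero_smul, zero_add]⟩

theorem exists_arr16_three_mul_eq {x : GAlg k Q16 Rel16}
    (hx : vtx16 k 0 * x = x) (h : arr16 k 5 * x = 0) : ∃ y, arr16 k 3 * y = x := by
  obtain ⟨c, d, d', hy⟩ := vtx16_zero_mul_eq x
  rw [hx] at hy
  rw [hy, mul_add, mul_add, mul_smul_comm, mul_smul_comm, mul_smul_comm, arr16_mul_vtx16,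
    if_pos (by decide), arr16_mul_arr16_eq_zero (b := 3) (by decide) (by decide), smul_zero,
    add_zero] at h
  have hc : c • arr16 k 5 = 0 := by
    have := congrArg (· * vtx16 k 0) h
    simpa [add_mul, mul_assoc, arr16_mul_vtx16] using this
  obtain rfl := (smul_eq_zero.1 hc).resolve_right arr16_five_ne_zero
  rw [zero_smul, zero_add] at h
  obtain rfl := (smul_eq_zero.1 h).resolve_right arr16_five_mul_zero_ne_zero
  exact ⟨algebraMap k _ d', by rw [hy]; simp [Algebra.algebraMap_eq_smul_one]⟩

theorem exists_mul_arr16_five_eq {x : GAlg k Q16 Rel16}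
    (hx : x * vtx16 k 0 = x) (h : x * arr16 k 3 = 0) : ∃ y, y * arr16 k 5 = x := by
  obtain ⟨c, d, d', hy⟩ := mul_vtx16_zero_eq x
  rw [hx] at hy
  rw [hy, add_mul, add_mul, smul_mul_assoc, smul_mul_assoc, smul_mul_assoc, vtx16_mul_arr16,
    if_pos (by decide), arr16_mul_arr16_eq_zero (a := 5) (by decide) (by decide), smul_zero,
    add_zero] at h
  have hc : c • arr16 k 3 = 0 := by
    have := congrArg (vtx16 k 0 * ·) h
    simpa [mul_add, ← mul_assoc, vtx16_mul_arr16] using this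
  obtain rfl := (smul_eq_zero.1 hc).resolve_right arr16_three_ne_zero
  rw [zero_smul, zero_add] at h
  obtain rfl := (smul_eq_zero.1 h).resolve_right arr16_two_mul_three_ne_zero
  exact ⟨algebraMap k _ d', by rw [hy]; simp [Algebra.algebraMap_eq_smul_one]⟩

theorem isGProjMod_of_equiv_rIdeal_arr16_four (M : Type) [AddCommGroup M]
    [Module (GAlg k Q16 Rel16)ᵐᵒᵖ M]
    (f : M ≃ₗ[(GAlg k Q16 Rel16)ᵐᵒᵖ] rIdeal (GAlg k Q16 Rel16) (arr16 k 4)) :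
    IsGProjMod (GAlg k Q16 Rel16) M := by
  refine isGProjMod_of_exact_seq (fun n => cycleVtx k n) (fun n => cycleArr k n)
    (fun n => ?_) (fun n => ?_) (fun n => ?_) (fun n => ?_) (fun n => ?_) (fun n => ?_) M f <;>
    push_cast <;> generalize (n : ZMod 3) = i <;> revert i <;>
    apply forall_zmod_three
  · exact vtx16_mul_self 3
  · exact vtx16_mul_self 0
  · exact vtx16_mul_self 4
  · exact vtxA_src_mul_arrA (Q := Q16) 3
  · exact vtxA_src_mul_arrA (Q := Q16) 5
  · exact vtxA_src_mul_arrA (Q := Q16) 4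
  · exact arrA_mul_vtxA_tgt (Q := Q16) 3
  · exact arrA_mul_vtxA_tgt (Q := Q16) 5
  · exact arrA_mul_vtxA_tgt (Q := Q16) 4
  · exact arr16_mul_arr16_eq_zero (a := 5) (b := 3) (by decide) (by decide)
  · exact arr16_mul_arr16_eq_zero (a := 4) (b := 5) (by decide) (by decide)
  · exact arr16_mul_arr16_eq_zero (a := 3) (b := 4) (by decide) (by decide)
  · exact fun x => exists_arr16_three_mul_eq
  · exact fun x => exists_mul_eq_of_mul_eq_zero (v := 4) (a := 5) (b := 4) (by decide) rfl
      arr16_four_ne_zero (arr16_mul_arr16_eq_zero (by decide) (by decide))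
  · exact fun x => exists_mul_eq_of_mul_eq_zero (v := 3) (a := 4) (b := 3) (by decide) rfl
      arr16_three_ne_zero (arr16_mul_arr16_eq_zero (by decide) (by decide))
  · exact fun x => exists_mul_arr16_five_eq
  · exact fun x => exists_eq_mul_of_mul_eq_zero (v := 4) (a := 4) (b := 5) (by decide) rfl
      arr16_five_ne_zero (arr16_mul_arr16_eq_zero (by decide) (by decide))
  · exact fun x => exists_eq_mul_of_mul_eq_zero (v := 3) (a := 3) (b := 4) (by decide) rfl
      arr16_four_ne_zero (arr16_mul_arr16_eq_zero (by decide) (by decide))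

section Module

variable {M : Type} [AddCommGroup M] [Module (GAlg k Q16 Rel16)ᵐᵒᵖ M] {m : M}

theorem exists_op_smul_eq (he : op (vtx16 k 4) • m = m) (hb : op (arr16 k 5) • m = 0)
    (r : GAlg k Q16 Rel16) : ∃ (c : k) (y : GAlg k Q16 Rel16),
      vtx16 k 4 * r = c • vtx16 k 4 + arr16 k 5 * y ∧
        op r • m = op (algebraMap k (GAlg k Q16 Rel16) c) • m := by
  obtain ⟨c, y, hy⟩ := exists_vtx16_mul_eq 4 5 (by decide) r
  refine ⟨c, y, hy, ?_⟩
  conv_lhs => rw [← he, ← mul_smul, ← op_mul, hy, op_add, add_smul, op_mul, mul_smul, hb,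
    smul_zero, add_zero, Algebra.smul_def, Algebra.commutes, op_mul, mul_smul, he]

theorem isSimpleModule_of_cyclic (hm : m ≠ 0) (he : op (vtx16 k 4) • m = m)
    (hb : op (arr16 k 5) • m = 0) (hspan : ∀ x : M, ∃ r : GAlg k Q16 Rel16, op r • m = x) :
    IsSimpleModule (GAlg k Q16 Rel16)ᵐᵒᵖ M := by
  rw [isSimpleModule_iff_toSpanSingleton_surjective]
  refine ⟨⟨m, 0, hm⟩, fun x hx y => ?_⟩
  obtain ⟨r, rfl⟩ := hspan x
  obtain ⟨s, rfl⟩ := hspan y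
  obtain ⟨c, -, -, hc⟩ := exists_op_smul_eq he hb r
  have hc0 : c ≠ 0 := by
    rintro rfl
    exact hx (by rw [hc, map_zero, op_zero, zero_smul])
  refine ⟨op (algebraMap k (GAlg k Q16 Rel16) c⁻¹ * s), ?_⟩
  rw [LinearMap.toSpanSingleton_apply, hc, ← mul_smul, ← op_mul, ← mul_assoc, ← map_mul,
    mul_inv_cancel₀ hc0, map_one, one_mul]

theorem not_projective_of_cyclic (hm : m ≠ 0) (he : op (vtx16 k 4) • m = m)
    (hb : op (arr16 k 5) • m = 0) (hspan : ∀ x : M, ∃ r : GAlg k Q16 Rel16, op r • m = x) :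
    ¬ Module.Projective (GAlg k Q16 Rel16)ᵐᵒᵖ M := by
  intro hproj
  obtain ⟨s, hs⟩ := Module.projective_lifting_property
    (LinearMap.toSpanSingleton (GAlg k Q16 Rel16)ᵐᵒᵖ M m) LinearMap.id
    (fun x => (hspan x).elim fun r hr => ⟨op r, hr⟩)
  have hsm : s m • m = m := LinearMap.congr_fun hs m
  have h4 : (s m).unop * vtx16 k 4 = (s m).unop :=
    congrArg unop ((map_smul s (op (vtx16 k 4)) m).symm.trans (by rw [he]))
  have h5 : (s m).unop * arr16 k 5 = 0 :=
    congrArg unop ((map_smul s (op (arr16 k 5)) m).symm.trans (by rw [hb, map_zero]; rfl))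
  obtain ⟨z, hz⟩ := exists_eq_mul_of_mul_eq_zero (v := 4) (a := 4) (b := 5) (by decide) rfl
    arr16_five_ne_zero (arr16_mul_arr16_eq_zero (by decide) (by decide)) h4 h5
  obtain ⟨c, -, -, hc⟩ := exists_op_smul_eq he hb z
  refine hm ?_
  rw [← hsm, ← op_unop (s m), ← hz, op_mul, mul_smul, hc, ← mul_smul, ← op_mul,
    Algebra.commutes, op_mul, mul_smul]
  nth_rw 1 [← he]
  rw [← mul_smul (op (arr16 k 4)), ← op_mul, vtx16_mul_arr16, if_neg (by decide), op_zero,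
    zero_smul, smul_zero]

theorem isGProjMod_of_cyclic (he : op (vtx16 k 4) • m = m) (hb : op (arr16 k 5) • m = 0)
    (hm : m ≠ 0) (hspan : ∀ x : M, ∃ r : GAlg k Q16 Rel16, op r • m = x) :
    IsGProjMod (GAlg k Q16 Rel16) M := by
  obtain ⟨f⟩ := nonempty_linearEquiv_of_ker_eq
    (LinearMap.toSpanSingleton (GAlg k Q16 Rel16)ᵐᵒᵖ M m)
    (LinearMap.toSpanSingleton (GAlg k Q16 Rel16)ᵐᵒᵖ (rIdeal (GAlg k Q16 Rel16) (arr16 k 4))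
      ⟨arr16 k 4, self_mem_rIdeal _⟩)
    (fun x => (hspan x).elim fun r hr => ⟨op r, hr⟩)
    (fun x => (mem_rIdeal.1 x.2).elim fun r hr => ⟨op r, Subtype.ext hr⟩) (by
      ext r
      obtain ⟨c, y, hy, hc⟩ := exists_op_smul_eq he hb r.unop
      have h4 : arr16 k 4 * r.unop = c • arr16 k 4 := by
        have h : arr16 k 4 * vtx16 k 4 = arr16 k 4 := arrA_mul_vtxA_tgt (Q := Q16) 4
        rw [← h, mul_assoc, hy, mul_add, ← mul_assoc,
          arr16_mul_arr16_eq_zero (by decide) (by decide), zero_mul, add_zero, mul_smul_comm]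
      have hM : r • m = 0 ↔ c = 0 := by
        constructor
        · intro h
          by_contra hc0
          refine hm ?_
          rw [← op_unop r, hc] at h
          rw [← one_smul (GAlg k Q16 Rel16)ᵐᵒᵖ m, ← op_one, ← map_one (algebraMap k (GAlg k Q16 Rel16)),
            ← mul_inv_cancel₀ hc0, map_mul, op_mul, mul_smul, h, smul_zero]
        · rintro rfl
          rw [← op_unop r, hc, map_zero, op_zero, zero_smul]
      have hI : arr16 k 4 * r.unop = 0 ↔ c = 0 := by
        rw [h4, smul_eq_zero, or_iff_left arr16_four_ne_zero]
      rw [LinearMap.mem_ker, LinearMap.mem_ker, LinearMap.toSpanSingleton_apply, hM, ← hI]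
      exact ⟨fun h => Subtype.ext h, fun h => congrArg Subtype.val h⟩)
  exact isGProjMod_of_equiv_rIdeal_arr16_four M f

theorem isNPIGProj_of_cyclic (hm : m ≠ 0) (he : op (vtx16 k 4) • m = m)
    (hb : op (arr16 k 5) • m = 0) (hspan : ∀ x : M, ∃ r : GAlg k Q16 Rel16, op r • m = x) :
    IsNPIGProj (GAlg k Q16 Rel16) M := by
  have := isSimpleModule_of_cyclic hm he hb hspan
  exact ⟨isGProjMod_of_cyclic he hb hm hspan, isIndec_of_isSimpleModule _ _,
    not_projective_of_cyclic hm he hb hspan⟩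

end Module

end Example

/-- Example `examp:counter-examp`.  For the gentle algebra
`A = kQ/I` above and `Ā = A/Aε_1A`:  the simple module `S(3')` — realized as the
right ideal `ε̄_{3'}Ā` of `Ā` — is a simple, indecomposable, projective right
`Ā`-module, while viewed as a right `A`-module (via `A → Ā`) it is a
non-projective indecomposable Gorenstein projective `A`-module. -/
theorem stmt16 (k : Type) [Field k] [IsAlgClosed k] :
    let A := GAlg k Q16 Rel16
    let ε := vtxA k Q16 Rel16 0
    let Abar := QuotBy A ε
    let π := qmap A ε
    let M := ↥(rIdeal Abar (π (vtxA k Q16 Rel16 4)))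
    IsSimpleModule Abarᵐᵒᵖ M ∧ Module.Projective Abarᵐᵒᵖ M ∧
      IsIndec Abarᵐᵒᵖ M ∧ RestrIsNPIGProj π M := by
  intro A ε Abar π M
  have hπ : Function.Surjective π := RingQuot.mkRingHom_surjective _
  have hε : π ε = 0 := by
    have h : QuotRel A ε ε 0 := ⟨rfl, rfl⟩
    exact (RingQuot.mkRingHom_rel h).trans (map_zero _)
  let f : Abar := π (vtxA k Q16 Rel16 4)
  let m : M := ⟨f, self_mem_rIdeal f⟩
  have hff : f * f = f := by
    rw [← map_mul]
    exact congrArg π (vtx16_mul_self 4)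
  have hm : m ≠ 0 := fun h => qmap_vtx16_four_ne_zero (congrArg Subtype.val h)
  have hspan : ∀ x : M, ∃ r : A, op (π r) • m = x := by
    intro x
    obtain ⟨y, hy⟩ := mem_rIdeal.1 x.2
    obtain ⟨r, rfl⟩ := hπ y
    exact ⟨r, Subtype.ext hy⟩
  have he : op (π (vtx16 k 4)) • m = m := Subtype.ext hff
  have hb : op (π (arr16 k 5)) • m = 0 := by
    refine Subtype.ext ?_
    change π (vtx16 k 4) * π (arr16 k 5) = 0
    have h : arr16 k 5 * vtx16 k 0 = arr16 k 5 := arrA_mul_vtxA_tgt (Q := Q16) 5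
    rw [← h, map_mul]
    change _ * (_ * π ε) = 0
    rw [hε, mul_zero, mul_zero]
  let inst : Module Aᵐᵒᵖ M := modRestrict π M
  have hA : IsSimpleModule Aᵐᵒᵖ M := isSimpleModule_of_cyclic hm he hb hspan
  have hAbar : IsSimpleModule Abarᵐᵒᵖ M := by
    rw [isSimpleModule_iff_toSpanSingleton_surjective] at hA ⊢
    exact ⟨hA.1, fun x hx y => (hA.2 x hx y).elim fun r hr => ⟨op (π r.unop), hr⟩⟩
  exact ⟨hAbar, projective_rIdeal hff, isIndec_of_isSimpleModule _ _,
    isNPIGProj_of_cyclic hm he hb hspan⟩
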